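/- Let n be even, L a 2-linear polynomial over F_{q^n} with ker(Tr_2 ∘ L') ⊆ ker Tr. Then the map x ↦ Tr(x^{q+1}) + L(x) is N-to-1 on F_{q^n} with N = |ker L'|; that is, every element of F_{q^n} has either 0 or exactly N preimages under this map. -/

import Mathlib

/-- For an adjoint pair `(f', f)` with respect to a nondegenerate reflexive form, the kernel of the
adjoint is the orthogonal complement of the range. -/
theorem LinearMap.BilinForm.orthogonal_range_eq_ker {K V : Type*} [Field K] [AddCommGroup V]
    [Module K V] {B : LinearMap.BilinForm K V} (hB : B.Nondegenerate) (hr : B.IsRefl)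
    {f f' : V →ₗ[K] V} (hf : ∀ x y, B x (f y) = B (f' x) y) :
    B.orthogonal (LinearMap.range f) = LinearMap.ker f' := by
  ext x
  simp only [LinearMap.BilinForm.mem_orthogonal_iff, LinearMap.mem_ker, LinearMap.mem_range]
  constructor
  · intro h
    refine hB.1 _ fun y => ?_
    rw [← hf]
    exact hr _ _ (h _ ⟨y, rfl⟩)
  · rintro h _ ⟨y, rfl⟩
    apply hr
    rw [hf, h]
    simp

theorem LinearMap.BilinForm.finrank_ker_eq_of_adjoint {K V : Type*} [Field K] [AddCommGroup V]
    [Module K V] [FiniteDimensional K V] {B : LinearMap.BilinForm K V} (hB : B.Nondegenerate)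
    (hr : B.IsRefl) {f f' : V →ₗ[K] V} (hf : ∀ x y, B x (f y) = B (f' x) y) :
    Module.finrank K (LinearMap.ker f) = Module.finrank K (LinearMap.ker f') := by
  have h1 := LinearMap.BilinForm.finrank_orthogonal hB (LinearMap.range f)
  rw [orthogonal_range_eq_ker hB hr hf] at h1
  have h2 := f.finrank_range_add_finrank_ker
  omega

theorem LinearMap.BilinForm.mem_range_of_adjoint {K V : Type*} [Field K] [AddCommGroup V]
    [Module K V] [FiniteDimensional K V] {B : LinearMap.BilinForm K V} (hB : B.Nondegenerate)
    (hr : B.IsRefl) {f f' : V →ₗ[K] V} (hf : ∀ x y, B x (f y) = B (f' x) y) {w : V}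
    (hw : ∀ x, f' x = 0 → B x w = 0) : w ∈ LinearMap.range f := by
  rw [← LinearMap.BilinForm.orthogonal_orthogonal hB hr (LinearMap.range f),
    orthogonal_range_eq_ker hB hr hf, LinearMap.BilinForm.mem_orthogonal_iff]
  exact fun x hx => hw x hx

/-- A nonempty fibre of an additive map is equinumerous with its kernel. -/
theorem AddMonoidHom.card_fiber_eq_zero_or_card_ker {G H : Type*} [AddGroup G] [AddGroup H]
    (f : G →+ H) (y : H) :
    Nat.card {x : G // f x = y} = 0 ∨
      Nat.card {x : G // f x = y} = Nat.card {x : G // f x = 0} := by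
  by_cases hy : ∃ x₀, f x₀ = y
  · obtain ⟨x₀, rfl⟩ := hy
    right
    refine Nat.card_congr ((Equiv.subRight x₀).subtypeEquiv fun x => ?_)
    simp [sub_eq_zero]
  · left
    have : IsEmpty {x : G // f x = y} := ⟨fun x => hy ⟨x.1, x.2⟩⟩
    exact Nat.card_of_isEmpty

section FiniteField

variable {F : Type*} [Field F] [Fintype F]

theorem FiniteField.trace_pow_two_pow [Algebra (ZMod 2) F] (x : F) (k : ℕ) :
    Algebra.trace (ZMod 2) F (x ^ 2 ^ k) = Algebra.trace (ZMod 2) F x := by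
  have : CharP F 2 := charP_of_injective_algebraMap (algebraMap (ZMod 2) F).injective 2
  have key (y : F) : Algebra.trace (ZMod 2) F (y ^ 2) = Algebra.trace (ZMod 2) F y := by
    have := Algebra.trace_eq_of_algEquiv (FiniteField.frobeniusAlgEquiv (ZMod 2) F 2) y
    simpa [ZMod.card] using this
  induction k with
  | zero => simp
  | succ k ih => rw [pow_succ, pow_mul, key, ih]

theorem FiniteField.trace_mul_pow_two_pow [Algebra (ZMod 2) F] {d i : ℕ}
    (hF : Fintype.card F = 2 ^ d) (hi : i ≤ d) (x y : F) :
    Algebra.trace (ZMod 2) F (x * y ^ 2 ^ i) =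
      Algebra.trace (ZMod 2) F (x ^ 2 ^ (d - i) * y) := by
  rw [← trace_pow_two_pow (x * y ^ 2 ^ i) (d - i), mul_pow, ← pow_mul, ← pow_add,
    Nat.add_sub_cancel' hi, ← hF, FiniteField.pow_card]

theorem FiniteField.sum_pow_pow_frobenius {Q k : ℕ} (hF : Fintype.card F = Q ^ k) (x : F) :
    ∑ i ∈ Finset.range k, x ^ Q ^ (i + 1) = ∑ i ∈ Finset.range k, x ^ Q ^ i := by
  have h1 := Finset.sum_range_succ (fun i => x ^ Q ^ i) k
  rw [Finset.sum_range_succ', ← hF, FiniteField.pow_card, pow_zero, pow_one] at h1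
  exact add_right_cancel h1

theorem FiniteField.trace_mul_sum_pow_pow [Algebra (ZMod 2) F] {r k : ℕ}
    (hF : Fintype.card F = (2 ^ r) ^ k) (x y : F) :
    Algebra.trace (ZMod 2) F (x * ∑ i ∈ Finset.range k, y ^ (2 ^ r) ^ i) =
      Algebra.trace (ZMod 2) F ((∑ i ∈ Finset.range k, x ^ (2 ^ r) ^ i) * y) := by
  rw [← sum_pow_pow_frobenius hF x, Finset.mul_sum, Finset.sum_mul, map_sum, map_sum,
    ← Finset.sum_range_reflect]
  refine Finset.sum_congr rfl fun i hi => ?_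
  have hi := Finset.mem_range.1 hi
  rw [← pow_mul] at hF
  rw [← pow_mul, ← pow_mul, trace_mul_pow_two_pow hF (Nat.mul_le_mul_left r (by omega)),
    ← Nat.mul_sub]
  congr 5
  omega

theorem FiniteField.sum_pow_pow_pow [CharP F 2] {r k : ℕ} (hF : Fintype.card F = (2 ^ r) ^ k)
    (x : F) : (∑ i ∈ Finset.range k, x ^ (2 ^ r) ^ i) ^ 2 ^ r =
      ∑ i ∈ Finset.range k, x ^ (2 ^ r) ^ i := by
  rw [sum_pow_char_pow, ← sum_pow_pow_frobenius hF x]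
  exact Finset.sum_congr rfl fun i _ => by rw [← pow_mul, ← pow_succ]

end FiniteField

/-- Let `n` be even, `q = 2^m`, `F` the field with `q^n` elements, and `L` a
`2`-linear polynomial over `F` with adjoint `L'` such that `ker(Tr_2 ∘ L') ⊆ ker Tr`.  Then
`x ↦ Tr(x^(q+1)) + L(x)` is `N`-to-`1` on `F` with `N = |ker L'|`: every element of `F` has
either `0` or exactly `N` preimages. -/
theorem stmt_16 (m n : ℕ) (hm : 0 < m) (hn : Even n) (hn0 : 0 < n)
    (F : Type*) [Field F] [Fintype F] (hF : Fintype.card F = 2 ^ (m * n))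
    (a : Fin (m * n) → F)
    (L L' Tr Tr2 : F → F)
    (hL : ∀ x, L x = ∑ i : Fin (m * n), a i * x ^ 2 ^ (i : ℕ))
    (hL' : ∀ x, L' x = ∑ i : Fin (m * n), (a i * x) ^ 2 ^ (m * n - (i : ℕ)))
    (hTr : ∀ x, Tr x = ∑ i ∈ Finset.range n, x ^ (2 ^ m) ^ i)
    (hTr2 : ∀ x, Tr2 x = ∑ i ∈ Finset.range (n / 2), x ^ ((2 ^ m) ^ 2) ^ i)
    (h : ∀ x : F, Tr2 (L' x) = 0 → Tr x = 0) :
    ∀ y : F,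
      Nat.card {x : F // Tr (x ^ (2 ^ m + 1)) + L x = y} = 0 ∨
      Nat.card {x : F // Tr (x ^ (2 ^ m + 1)) + L x = y} =
        Nat.card {x : F // L' x = 0} := by
  have : CharP F 2 := charP_of_card_eq_prime_pow hF
  let _ : Algebra (ZMod 2) F := ZMod.algebra F 2
  have : FiniteDimensional (ZMod 2) F := Module.Finite.of_finite
  have hFq : Fintype.card F = (2 ^ m) ^ n := by rw [hF, pow_mul]
  have hFq2 : Fintype.card F = (2 ^ (m * 2)) ^ (n / 2) := by
    rw [hF, ← pow_mul, mul_assoc, Nat.two_mul_div_two_of_even hn]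
  simp only [← pow_mul 2 m 2] at hTr2
  have hLadd (x y : F) : L (x + y) = L x + L y := by
    simp only [hL, add_pow_char_pow, mul_add, Finset.sum_add_distrib]
  have hL'add (x y : F) : L' (x + y) = L' x + L' y := by
    simp only [hL', add_pow_char_pow, mul_add, Finset.sum_add_distrib]
  have hTradd (x y : F) : Tr (x + y) = Tr x + Tr y := by
    simp only [hTr, ← pow_mul, add_pow_char_pow, Finset.sum_add_distrib]
  have hTr2add (x y : F) : Tr2 (x + y) = Tr2 x + Tr2 y := by
    simp only [hTr2, ← pow_mul, add_pow_char_pow, Finset.sum_add_distrib]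
  let l : F →ₗ[ZMod 2] F := (AddMonoidHom.mk' L hLadd).toZModLinearMap 2
  let l' : F →ₗ[ZMod 2] F := (AddMonoidHom.mk' L' hL'add).toZModLinearMap 2
  let t2 : F →ₗ[ZMod 2] F := (AddMonoidHom.mk' Tr2 hTr2add).toZModLinearMap 2
  let B := Algebra.traceForm (ZMod 2) F
  have hB : B.Nondegenerate := traceForm_nondegenerate _ _
  have hr : B.IsRefl := (Algebra.traceForm_isSymm (ZMod 2)).isRefl
  have hadj (x y : F) : B x (l y) = B (l' x) y := by
    change Algebra.trace (ZMod 2) F (x * L y) = Algebra.trace (ZMod 2) F (L' x * y)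
    rw [hL, hL', Finset.mul_sum, Finset.sum_mul, map_sum, map_sum]
    refine Finset.sum_congr rfl fun i _ => ?_
    rw [← FiniteField.trace_mul_pow_two_pow hF i.2.le, ← mul_assoc, mul_comm x]
  have hadj2 (x y : F) : B x ((l ∘ₗ t2) y) = B ((t2 ∘ₗ l') x) y := by
    change B x (l (t2 y)) = _
    rw [hadj]
    change Algebra.trace (ZMod 2) F (L' x * Tr2 y) = Algebra.trace (ZMod 2) F (Tr2 (L' x) * y)
    rw [hTr2, hTr2, FiniteField.trace_mul_sum_pow_pow hFq2]
  have hcard : Nat.card {x : F // L x = 0} = Nat.card {x : F // L' x = 0} := by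
    change Nat.card (LinearMap.ker l) = Nat.card (LinearMap.ker l')
    rw [Module.natCard_eq_pow_finrank (K := ZMod 2),
      Module.natCard_eq_pow_finrank (K := ZMod 2) (V := LinearMap.ker l'),
      LinearMap.BilinForm.finrank_ker_eq_of_adjoint hB hr hadj]
  have hex (c : F) : ∃ v, ∀ d, Tr d = c → L (Tr2 v) = c := by
    by_cases hc : ∃ d, Tr d = c
    swap
    · exact ⟨0, fun d hd => (hc ⟨d, hd⟩).elim⟩
    obtain ⟨d, rfl⟩ := hc
    suffices ∃ v, L (Tr2 v) = Tr d from this.imp fun v hv _ _ => hv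
    refine LinearMap.BilinForm.mem_range_of_adjoint hB hr hadj2 fun x hx => ?_
    change Algebra.trace (ZMod 2) F (x * Tr d) = 0
    rw [hTr, FiniteField.trace_mul_sum_pow_pow hFq, ← hTr, h x hx, zero_mul, map_zero]
  have hTrpow (x : F) : Tr (x ^ 2 ^ m) = Tr x := by
    rw [hTr, hTr, ← FiniteField.sum_pow_pow_frobenius hFq x]
    exact Finset.sum_congr rfl fun i _ => by rw [← pow_mul, ← pow_succ']
  have hshift (x v : F) : Tr ((x + Tr2 v) ^ (2 ^ m + 1)) = Tr (x ^ (2 ^ m + 1)) := by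
    have hu : (Tr2 v ^ 2 ^ m) ^ 2 ^ m = Tr2 v := by
      rw [← pow_mul, ← pow_add, ← mul_two, hTr2, FiniteField.sum_pow_pow_pow hFq2]
    generalize Tr2 v = u at hu
    have h1 : Tr (u ^ 2 ^ m * x) = Tr (x ^ 2 ^ m * u) := by
      rw [← hTrpow (u ^ 2 ^ m * x), mul_pow, hu, mul_comm]
    have h2 : Tr (u ^ (2 ^ m + 1)) = 0 := by
      have hw : (u ^ (2 ^ m + 1)) ^ 2 ^ m = u ^ (2 ^ m + 1) := by
        rw [pow_succ, mul_pow, hu, mul_comm]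
      generalize u ^ (2 ^ m + 1) = w at hw
      have hw' (i : ℕ) : w ^ (2 ^ m) ^ i = w := by
        induction i with
        | zero => simp
        | succ i ih => rw [pow_succ, pow_mul, ih, hw]
      simp [hTr, hw', (CharP.cast_eq_zero_iff F 2 n).2 hn.two_dvd]
    have h3 : (x + u) ^ (2 ^ m + 1) =
        x ^ (2 ^ m + 1) + x ^ 2 ^ m * u + u ^ 2 ^ m * x + u ^ (2 ^ m + 1) := by
      rw [pow_succ, add_pow_char_pow]
      ring
    rw [h3, hTradd, hTradd, hTradd, h1, h2, add_zero, add_assoc, CharTwo.add_self_eq_zero,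
      add_zero]
  choose V hV using hex
  let g (x : F) : F := x + Tr2 (V (Tr (x ^ (2 ^ m + 1))))
  have hg : Function.Involutive g := fun x => by
    simp only [g, hshift, add_assoc, CharTwo.add_self_eq_zero, add_zero]
  have hfg (x : F) : Tr (x ^ (2 ^ m + 1)) + L x = L (g x) := by
    rw [hLadd, hV _ _ rfl, add_comm]
  have hfiber (y : F) : Nat.card {x : F // Tr (x ^ (2 ^ m + 1)) + L x = y} =
      Nat.card {x : F // L x = y} :=
    Nat.card_congr (hg.toPerm.subtypeEquiv fun x => by rw [hfg]; rfl)
  intro y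
  rw [hfiber, ← hcard]
  exact (AddMonoidHom.mk' L hLadd).card_fiber_eq_zero_or_card_ker y
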